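/- Pointwise limit of the bilateral finite sum: for fixed complex q with 0 < |q| < 1 and nonzero complex x avoiding poles, the finite bilateral sums F_{m,n}(x) := \sum_{k=-m}^{n}(1-xq^k)\binom{m+n}{m+k}_q \frac{(-x;q)_{1+n}(-q/x;q)_m}{(x^2;q)_{1+n+k}(q/x^2;q)_{m-k}} x^{3k} q^{k^2+\binom{k}{2}} satisfy F_{m,n}(x) = 1 for all m, n, and for each fixed k, \lim_{m,n\to\infty} \binom{m+n}{m+k}_q \frac{(-x;q)_{1+n}(-q/x;q)_m}{(x^2;q)_{1+n+k}(q/x^2;q)_{m-k}} = \frac{1}{(q;q)_\infty} \cdot \frac{(-x;q)_\infty(-q/x;q)_\infty}{(x^2;q)_\infty(q/x^2;q)_\infty}. -/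

import Mathlib

open Filter

/-- The q-shifted factorial `(a;q)_n = ∏_{j=0}^{n-1} (1 - a q^j)`. -/
noncomputable def qPoch (a q : ℂ) (n : ℕ) : ℂ :=
  ∏ j ∈ Finset.range n, (1 - a * q ^ j)

/-- The q-shifted factorial with integer index. -/
noncomputable def qPochZ (a q : ℂ) (n : ℤ) : ℂ :=
  if 0 ≤ n then ∏ j ∈ Finset.range n.toNat, (1 - a * q ^ (j : ℤ))
  else (∏ j ∈ Finset.range (-n).toNat, (1 - a * q ^ (-(j : ℤ) - 1)))⁻¹

/-- The Gaussian binomial coefficient `(q;q)_m / ((q;q)_k (q;q)_{m-k})`. -/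
noncomputable def qBinom (q : ℂ) (m k : ℕ) : ℂ :=
  qPoch q q m / (qPoch q q k * qPoch q q (m - k))

/-- The infinite q-Pochhammer symbol `(a;q)_∞ = ∏_{j=0}^∞ (1 - a q^j)`. -/
noncomputable def qPochInf (a q : ℂ) : ℂ := ∏' j : ℕ, (1 - a * q ^ j)


theorem qp_succ (a q : ℂ) (n : ℕ) : qPoch a q (n+1) = qPoch a q n * (1 - a * q ^ n) := by
  simp [qPoch, Finset.prod_range_succ]

theorem qp_succ' (a q : ℂ) (n : ℕ) : qPoch a q (n+1) = (1 - a) * qPoch (a * q) q n := by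
  simp only [qPoch, Finset.prod_range_succ', pow_zero, mul_one]
  rw [mul_comm]
  congr 1
  apply Finset.prod_congr rfl
  intro j _
  ring

theorem qp_ne (a q : ℂ) (h : ∀ j : ℕ, 1 - a * q ^ j ≠ 0) (n : ℕ) : qPoch a q n ≠ 0 := by
  rw [qPoch, Finset.prod_ne_zero_iff]
  intro j _
  exact h j

noncomputable def bb (q : ℂ) (N k : ℕ) : ℂ := if k ≤ N then qBinom q N k else 0

theorem q_pow_ne {q : ℂ} (hq1 : ‖q‖ < 1) (j : ℕ) : 1 - q * q ^ j ≠ 0 := by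
  intro h
  have h1 : q ^ (j+1) = 1 := by rw [pow_succ']; linear_combination -h
  have h2 : ‖q‖ ^ (j+1) = 1 := by rw [← norm_pow, h1, norm_one]
  have : ‖q‖ ^ (j+1) < 1 := pow_lt_one₀ (norm_nonneg q) hq1 (Nat.succ_ne_zero j)
  linarith

theorem bb_zero {q : ℂ} (hq1 : ‖q‖ < 1) (N : ℕ) : bb q N 0 = 1 := by
  have := qp_ne q q (q_pow_ne hq1) N
  simp [bb, qBinom]
  rw [show qPoch q q 0 = 1 by simp [qPoch]]
  field_simp

theorem bb_r1 {q : ℂ} (hq1 : ‖q‖ < 1) (k d : ℕ) :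
    bb q (k+d) (k+1) = (1 - q ^ d) / (1 - q * q ^ k) * bb q (k+d) k := by
  have h := qp_ne q q (q_pow_ne hq1)
  have h' := q_pow_ne hq1
  rcases d with _ | d
  · simp [bb]
  · have e1 : k + (d+1) - k = d + 1 := by omega
    have e2 : k + (d+1) - (k+1) = d := by omega
    simp only [bb, qBinom, e1, e2]
    rw [if_pos (by omega), if_pos (by omega), qp_succ q q d, qp_succ q q k]
    have := h k
    have := h d
    have := h' k
    have := h' d
    field_simp
    ring

theorem bb_r2 {q : ℂ} (hq1 : ‖q‖ < 1) (k d : ℕ) :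
    bb q (k+d+1) (k+1) = (1 - q * q ^ (k+d)) / (1 - q * q ^ k) * bb q (k+d) k := by
  have h := qp_ne q q (q_pow_ne hq1)
  have h' := q_pow_ne hq1
  have e1 : k + d - k = d := by omega
  have e2 : k + d + 1 - (k+1) = d := by omega
  simp only [bb, qBinom, e1, e2]
  rw [if_pos (by omega), if_pos (by omega), qp_succ q q k, qp_succ q q (k+d)]
  have := h k
  have := h d
  have := h' k
  field_simp

noncomputable def FF (q z : ℂ) (N k : ℕ) : ℂ :=
  (1 + z * q ^ k) * bb q N k * (qPoch z q (N+1) / qPoch (z^2 * q^k) q (N+1)) * z ^ k * q ^ (k^2)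

noncomputable def GG (q z : ℂ) (N k : ℕ) : ℂ :=
  - bb q N k * (qPoch z q (N+1) / qPoch (z^2 * q^(k+1)) q (N+1)) * z ^ (k+1) * q ^ (k^2+k+1+N)

theorem alg1 (q z W Q D Z P R b : ℂ) (hP : P ≠ 0) (h1 : 1 - z^2 * (Q * q) ≠ 0)
    (h2 : 1 - z^2 * (Q * q) * (Q * D * q) ≠ 0) (hk : 1 - q * Q ≠ 0) :
    (1 + z * (Q * q)) * ((1 - q * (Q * D)) / (1 - q * Q) * b) *
      (R * (1 - z * (Q * D * q)) / (P * (1 - z^2 * (Q * q) * (Q * D * q)))) * (Z * z) *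
        (W * Q * Q * q) -
    (1 + z * (Q * q)) * ((1 - D) / (1 - q * Q) * b) * (R / P) * (Z * z) * (W * Q * Q * q) =
    -((1 - D) / (1 - q * Q) * b) *
      (R / (P * (1 - z^2 * (Q * q) * (Q * D * q)) / (1 - z^2 * (Q * q)))) * (Z * z * z) *
        (W * Q * Q * Q * Q * D * q^3) -
    -b * (R / P) * (Z * z) * (W * Q * Q * D * q) := by
  obtain ⟨u, hu⟩ : ∃ u, u = 1 - z^2 * (Q * q) := ⟨_, rfl⟩
  obtain ⟨v, hv⟩ : ∃ u, u = 1 - z^2 * (Q * q) * (Q * D * q) := ⟨_, rfl⟩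
  obtain ⟨w, hw⟩ : ∃ u, u = 1 - q * Q := ⟨_, rfl⟩
  rw [← hu] at h1
  rw [← hv] at h2
  rw [← hw] at hk
  rw [← hu, ← hv, ← hw]
  field_simp
  subst hu hv hw
  ring

theorem alg2 (q z Q P R : ℂ) (hP : P ≠ 0) (h1 : 1 - z^2 ≠ 0)
    (h2 : 1 - z^2 * (Q * q) ≠ 0) :
    (1 + z) * (R * (1 - z * (Q * q)) / ((1 - z^2) * P * (1 - z^2 * (Q * q)))) -
    (1 + z) * (R / ((1 - z^2) * P)) =
    -1 * (R / (P * (1 - z^2 * (Q * q)))) * z * (Q * q) := by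
  obtain ⟨u, hu⟩ : ∃ u, u = 1 - z^2 := ⟨_, rfl⟩
  obtain ⟨v, hv⟩ : ∃ u, u = 1 - z^2 * (Q * q) := ⟨_, rfl⟩
  rw [← hu] at h1
  rw [← hv] at h2
  rw [← hu, ← hv]
  field_simp
  subst hu hv
  ring

theorem FG_step {q z : ℂ} (hq1 : ‖q‖ < 1) (hz : ∀ j : ℕ, 1 - z^2 * q ^ j ≠ 0) (k d : ℕ) :
    FF q z (k+d+1) (k+1) - FF q z (k+d) (k+1) = GG q z (k+d) (k+1) - GG q z (k+d) k := by
  have hz' : ∀ i n : ℕ, qPoch (z^2 * q^i) q n ≠ 0 := fun i n => qp_ne _ _ (fun j => by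
    rw [mul_assoc, ← pow_add]; exact hz _) n
  have hP := hz' (k+1) (k+d+1)
  have h1 := hz (k+1)
  have h2 : 1 - z^2 * q^(k+1) * q^(k+d+1) ≠ 0 := by
    rw [mul_assoc, ← pow_add]; exact hz _
  have e : qPoch (z^2 * q^(k+1+1)) q (k+d+1) =
      qPoch (z^2 * q^(k+1)) q (k+d+1) * (1 - z^2 * q^(k+1) * q^(k+d+1)) / (1 - z^2 * q^(k+1)) := by
    rw [eq_div_iff h1, ← qp_succ, qp_succ' (z^2 * q^(k+1)) q (k+d+1), pow_succ q (k+1), ← mul_assoc]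
    ring
  have hk := q_pow_ne hq1 k
  simp only [FF, GG]
  rw [bb_r1 hq1, bb_r2 hq1, e, qp_succ z q (k+d+1), qp_succ (z^2 * q^(k+1)) q (k+d+1)]
  generalize qPoch (z^2 * q^(k+1)) q (k+d+1) = P at *
  generalize qPoch z q (k+d+1) = R at *
  generalize bb q (k+d) k = b at *
  have x1 : q ^ ((k+1)^2) = q^(k^2) * q^k * q^k * q := by ring
  have x2 : q ^ ((k+1)^2+(k+1)+1+(k+d)) = q^(k^2) * q^k * q^k * q^k * q^k * q^d * q^3 := by ring
  have x3 : q ^ (k^2+k+1+(k+d)) = q^(k^2) * q^k * q^k * q^d * q := by ring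
  rw [x1, x2, x3]
  have y1 : q ^ (k+1) = q^k * q := pow_succ _ _
  have y2 : q ^ (k+d+1) = q^k * q^d * q := by rw [pow_succ, pow_add]
  have y3 : q ^ (k+d) = q^k * q^d := pow_add _ _ _
  have y4 : z ^ (k+1+1) = z^k * z * z := by rw [pow_succ, pow_succ]
  have y5 : z ^ (k+1) = z^k * z := by rw [pow_succ]
  clear e
  rw [y1, y2] at h2
  rw [y1] at h1
  rw [y1, y2, y3, y4, y5]
  exact alg1 _ _ _ _ _ _ _ _ _ hP h1 h2 hk

theorem FF_sum {q z : ℂ} (hq1 : ‖q‖ < 1) (hz : ∀ j : ℕ, 1 - z^2 * q ^ j ≠ 0) (N : ℕ) :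
    ∑ k ∈ Finset.range (N+1), FF q z N k = 1 := by
  have hz' : ∀ i n : ℕ, qPoch (z^2 * q^i) q n ≠ 0 := fun i n => qp_ne _ _ (fun j => by
    rw [mul_assoc, ← pow_add]; exact hz _) n
  induction N with
  | zero =>
    have := hz 0
    simp [FF, bb_zero hq1, qPoch] at *
    field_simp
    ring
  | succ N ih =>
    have hbN : bb q N (N+1) = 0 := by simp [bb]
    have h0 : FF q z N (N+1) = 0 := by simp [FF, hbN]
    have g0 : GG q z N (N+1) = 0 := by simp [GG, hbN]
    have ih' : ∑ k ∈ Finset.range (N+1+1), FF q z N k = 1 := by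
      rw [Finset.sum_range_succ, ih, h0, add_zero]
    rw [Finset.sum_range_succ'] at ih' ⊢
    have key : ∑ k ∈ Finset.range (N+1), (FF q z (N+1) (k+1) - FF q z N (k+1)) =
        ∑ k ∈ Finset.range (N+1), (GG q z N (k+1) - GG q z N k) := by
      apply Finset.sum_congr rfl
      intro k hk
      obtain ⟨d, rfl⟩ := Nat.exists_eq_add_of_le (Nat.lt_succ_iff.mp (Finset.mem_range.mp hk))
      exact FG_step hq1 hz k d
    rw [Finset.sum_range_sub, Finset.sum_sub_distrib, g0] at key
    have k0 : FF q z (N+1) 0 - FF q z N 0 = GG q z N 0 := by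
      have hP := hz' 1 N
      have a1 := hz 0
      have a2 := hz (N+1)
      have e1 : qPoch (z^2) q (N+1) = (1 - z^2) * qPoch (z^2*q^1) q N := by rw [qp_succ', pow_one]
      simp only [FF, GG, bb_zero hq1, pow_zero, mul_one]
      rw [qp_succ z q (N+1), qp_succ (z^2) q (N+1), e1, zero_add, qp_succ (z^2*q^1) q N]
      have y0 : z^2 * q^1 * q^N = z^2 * (q^N * q) := by ring
      have y1 : q ^ (0^2+0+1+N) = q^N * q := by ring
      rw [pow_zero, mul_one] at a1
      rw [pow_succ] at a2
      rw [y0, y1, pow_succ q N, pow_one z]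
      convert alg2 q z (q^N) _ (qPoch z q (N+1)) hP a1 a2 using 2 <;> simp
    linear_combination key + k0 + ih'

theorem qz_nat (a q : ℂ) (n : ℕ) : qPochZ a q n = qPoch a q n := by
  simp [qPochZ, qPoch]

theorem qz_succ {a q : ℂ} (h : ∀ j : ℤ, 1 - a * q ^ j ≠ 0) (s : ℤ) :
    qPochZ a q (s+1) = qPochZ a q s * (1 - a * q ^ s) := by
  rcases lt_or_ge s 0 with hs | hs
  · obtain ⟨t, rfl⟩ : ∃ t : ℕ, s = -(t:ℤ) - 1 := ⟨(-s-1).toNat, by omega⟩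
    have e1 : (-(-(t:ℤ) - 1)).toNat = t + 1 := by omega
    have hh := h (-(t:ℤ) - 1)
    have hz : qPochZ a q (-(t:ℤ) - 1) =
        (∏ j ∈ Finset.range (t+1), (1 - a * q ^ (-(j : ℤ) - 1)))⁻¹ := by
      rw [qPochZ, if_neg (by omega), e1]
    have hz2 : qPochZ a q (-(t:ℤ) - 1 + 1) =
        (∏ j ∈ Finset.range t, (1 - a * q ^ (-(j : ℤ) - 1)))⁻¹ := by
      rcases t with _ | t
      · simp [qPochZ]
      · rw [qPochZ, if_neg (by push_cast; omega)]
        congr 3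
    rw [hz, hz2, Finset.prod_range_succ, mul_inv, mul_assoc, inv_mul_cancel₀ hh, mul_one]
  · obtain ⟨t, rfl⟩ := Int.eq_ofNat_of_zero_le hs
    have := qz_nat a q (t+1)
    push_cast at this
    rw [this, qz_nat, qp_succ, zpow_natCast]

theorem qz_ne {a q : ℂ} (h : ∀ j : ℤ, 1 - a * q ^ j ≠ 0) (s : ℤ) : qPochZ a q s ≠ 0 := by
  rw [qPochZ]
  split_ifs
  · rw [Finset.prod_ne_zero_iff]; intro j _; exact h _
  · refine inv_ne_zero ?_
    rw [Finset.prod_ne_zero_iff]; intro j _; exact h _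

theorem tri_succ (s : ℤ) : (s+1) * (s+1+1) / 2 = s * (s+1) / 2 + (s+1) := by
  have : (s+1) * (s+1+1) = s * (s+1) + (s+1) * 2 := by ring
  rw [this, Int.add_mul_ediv_right _ _ (by norm_num)]

theorem inv_h {a q : ℂ} (hq : q ≠ 0) (ha : a ≠ 0) (h : ∀ j : ℤ, 1 - a * q ^ j ≠ 0) (j : ℤ) :
    1 - q / a * q ^ j ≠ 0 := by
  intro h0
  apply h (-j-1)
  have : q ^ j ≠ 0 := zpow_ne_zero _ hq
  rw [zpow_sub₀ hq, zpow_neg, zpow_one]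
  field_simp at h0 ⊢
  linear_combination -h0

theorem refl_base {a q : ℂ} (hq : q ≠ 0) (ha : a ≠ 0) (h : ∀ j : ℤ, 1 - a * q ^ j ≠ 0) (s : ℤ) :
    qPochZ (q / a) q s * qPochZ a q (-s) * (-a) ^ s * q ^ (-(s * (s+1) / 2)) = 1 := by
  have step : ∀ s : ℤ,
      qPochZ (q / a) q (s+1) * qPochZ a q (-(s+1)) * (-a) ^ (s+1) * q ^ (-((s+1) * (s+1+1) / 2)) =
      qPochZ (q / a) q s * qPochZ a q (-s) * (-a) ^ s * q ^ (-(s * (s+1) / 2)) := by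
    intro s
    have h1 := qz_succ (inv_h hq ha h) s
    have h2 := qz_succ h (-(s+1))
    rw [show -(s+1)+1 = -s by ring] at h2
    rw [h1, h2, tri_succ, neg_add (s * (s+1) / 2), zpow_add₀ hq, zpow_add₀ (neg_ne_zero.mpr ha),
      zpow_neg q (s+1), zpow_add₀ hq s 1, zpow_one, zpow_one]
    have : q ^ s ≠ 0 := zpow_ne_zero _ hq
    field_simp
    ring
  induction s using Int.induction_on with
  | zero => simp [qPochZ]
  | succ i ih => rw [step, ih]
  | pred i ih =>
    have := step (-(i:ℤ) - 1)
    rw [← this, show -(i:ℤ) - 1 + 1 = -i by ring, ih]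

theorem refl_gen {a q : ℂ} (hq : q ≠ 0) (ha : a ≠ 0) (h : ∀ j : ℤ, 1 - a * q ^ j ≠ 0)
    (L : ℕ) (s t : ℤ) (hL : s + t = L) :
    qPoch (a * q ^ (-s)) q L =
      qPochZ (q / a) q s * qPochZ a q t * (-a) ^ s * q ^ (-(s * (s+1) / 2)) := by
  induction L generalizing t with
  | zero =>
    obtain rfl : t = -s := by push_cast at hL; omega
    rw [refl_base hq ha h]
    simp [qPoch]
  | succ L ih =>
    have e := ih (t-1) (by push_cast at hL; omega)
    have h2 := qz_succ h (t-1)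
    rw [sub_add_cancel] at h2
    rw [qp_succ, e, h2, mul_assoc a, ← zpow_natCast, ← zpow_add₀ hq,
      show -s + (L:ℤ) = t - 1 by push_cast at hL; omega]
    ring

theorem tri2 (s : ℤ) : 2 * (s * (s+1) / 2) = s * (s+1) :=
  Int.mul_ediv_cancel' (Int.even_mul_succ_self s).two_dvd

theorem key_exp {q x : ℂ} (hq : q ≠ 0) (hx : x ≠ 0) (i m : ℕ) (k : ℤ) (hik : (i:ℤ) = k + m) :
    (- -x)^(m:ℤ) * q ^ (-((m:ℤ) * (m+1) / 2)) * (-x * q ^ (-(m:ℤ)))^i * q^(i^2) =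
        (-x^2)^((m:ℤ)-k) * q ^ (-(((m:ℤ)-k) * ((m:ℤ)-k+1) / 2)) *
          (x ^ (3 * k) * q ^ (k ^ 2 + k * (k - 1) / 2)) := by
  have t1 := tri2 m
  have t2 := tri2 (m-k)
  have t3 := tri2 (k-1)
  rw [sub_add_cancel, mul_comm (k-1) k] at t3
  generalize (m:ℤ) * (m+1) / 2 = T1 at *
  generalize ((m:ℤ)-k) * ((m:ℤ)-k+1) / 2 = T2 at *
  generalize k * (k-1) / 2 = T3 at *
  have e1 : (-x * q ^ (-(m:ℤ)))^i = (-1:ℂ)^(k+m) * x ^ (k+m) * q ^ (-(m:ℤ) * (k+m)) := by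
    rw [← zpow_natCast, hik, mul_zpow, ← zpow_mul, neg_eq_neg_one_mul, mul_zpow]
  have e2 : q^(i^2) = q^((k+m)^2) := by
    rw [← hik, ← zpow_natCast]; push_cast; rfl
  have e3 : (-x^2)^((m:ℤ)-k) = (-1:ℂ)^(k+m) * x ^ (2 * ((m:ℤ) - k)) := by
    rw [neg_eq_neg_one_mul, mul_zpow, zpow_mul]
    congr 1
    rw [show (k + m : ℤ) = (m - k) + 2 * k by ring, zpow_add₀ (by norm_num), zpow_mul]
    norm_num
  rw [e1, e2, e3, neg_neg]
  have f1 : x ^ (m:ℤ) * x ^ (k+m) = x ^ (2 * ((m:ℤ) - k)) * x ^ (3*k) := by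
    rw [← zpow_add₀ hx, ← zpow_add₀ hx]; congr 1; ring
  have f2 : q ^ (-T1) * q ^ (-(m:ℤ) * (k+m)) * q^((k+m)^2) = q ^ (-T2) * q ^ (k^2 + T3) := by
    rw [← zpow_add₀ hq, ← zpow_add₀ hq, ← zpow_add₀ hq]; congr 1; linarith
  linear_combination (-1:ℂ)^(k+m) * q ^ (-T1) * q ^ (-(m:ℤ) * (k+m)) * q^((k+m)^2) * f1 +
    (-1:ℂ)^(k+m) * x ^ (2 * ((m:ℤ) - k)) * x ^ (3*k) * f2

theorem part1 (q x : ℂ) (hq0 : 0 < ‖q‖) (hq1 : ‖q‖ < 1) (hx : x ≠ 0)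
    (hden : ∀ j : ℤ, 1 - x ^ 2 * q ^ j ≠ 0) (m n : ℕ) :
      (1 : ℂ) = ∑ k ∈ Finset.Icc (-(m : ℤ)) (n : ℤ),
        (1 - x * q ^ k) * qBinom q (m + n) ((m : ℤ) + k).toNat *
          (qPoch (-x) q (1 + n) * qPoch (-(q / x)) q m /
            (qPochZ (x ^ 2) q (1 + (n : ℤ) + k) * qPochZ (q / x ^ 2) q ((m : ℤ) - k))) *
          x ^ (3 * k) * q ^ (k ^ 2 + k * (k - 1) / 2) := by
  have hq : q ≠ 0 := norm_pos_iff.mp hq0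
  have hx2 : x^2 ≠ 0 := pow_ne_zero _ hx
  have hxd : ∀ j : ℤ, 1 - (-x) * q ^ j ≠ 0 := by
    intro j h0
    apply hden (2*j)
    rw [show (2*j) = j + j by ring, zpow_add₀ hq]
    linear_combination (1 - x * q^j) * h0
  set z : ℂ := -x * q ^ (-(m:ℤ)) with hz
  have hzsq : z^2 = x^2 * q ^ (-(2*m:ℤ)) := by
    rw [hz, mul_pow, neg_sq, ← zpow_natCast (q ^ (-(m:ℤ))), ← zpow_mul]
    congr 2; push_cast; ring
  have hzd : ∀ j : ℕ, 1 - z^2 * q ^ j ≠ 0 := by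
    intro j
    rw [hzsq, mul_assoc, ← zpow_natCast q, ← zpow_add₀ hq]
    exact hden _
  refine (FF_sum hq1 hzd (m+n)).symm.trans ?_
  refine Finset.sum_bij (fun i _ => (i:ℤ) - m) ?_ ?_ ?_ ?_
  · intro i hi; simp at hi ⊢; omega
  · intro i _ j _ h; simpa using h
  · intro k hk
    simp at hk
    exact ⟨(k+m).toNat, by simp; omega, by omega⟩
  · intro i hi
    have hi' : i ≤ m + n := by simp at hi; omega
    obtain ⟨k, hk⟩ : ∃ k : ℤ, k = (i:ℤ) - m := ⟨_, rfl⟩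
    have hik : (i:ℤ) = k + m := by omega
    rw [← hk, show ((m:ℤ) + k).toNat = i by omega]
    have A := refl_gen hq (neg_ne_zero.mpr hx) hxd (m+n+1) m (1+n:ℕ) (by push_cast; ring)
    rw [qz_nat, qz_nat, div_neg] at A
    have B := refl_gen hq hx2 hden (m+n+1) (m-k) (1+n+k) (by push_cast; ring)
    have C1 := qz_ne hden (1+n+k)
    have C2 := qz_ne (inv_h hq hx2 hden) (m-k)
    have e1 : z^2 * q^i = x^2 * q ^ (-((m:ℤ) - k)) := by
      rw [hzsq, mul_assoc, ← zpow_natCast q, ← zpow_add₀ hq, hik]; ring_nf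
    have e2 : 1 + z * q^i = 1 - x * q^k := by
      rw [hz, mul_assoc, ← zpow_natCast q, ← zpow_add₀ hq, hik]; ring_nf
    rw [FF, bb, if_pos hi', e1, e2, A, B]
    generalize qPochZ (x^2) q (1+n+k) = P1 at *
    generalize qPochZ (q/x^2) q (m-k) = P2 at *
    have key : (- -x)^(m:ℤ) * q ^ (-((m:ℤ) * (m+1) / 2)) * (-x * q ^ (-(m:ℤ)))^i * q^(i^2) =
        (-x^2)^((m:ℤ)-k) * q ^ (-(((m:ℤ)-k) * ((m:ℤ)-k+1) / 2)) *
          (x ^ (3 * k) * q ^ (k ^ 2 + k * (k - 1) / 2)) := by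
      exact key_exp hq hx i m k hik
    have D1 : (-x^2)^((m:ℤ)-k) ≠ 0 := zpow_ne_zero _ (neg_ne_zero.mpr hx2)
    have D2 : q ^ (-(((m:ℤ)-k) * ((m:ℤ)-k+1) / 2)) ≠ 0 := zpow_ne_zero _ hq
    generalize (-x^2)^((m:ℤ)-k) = E1 at *
    generalize q ^ (-(((m:ℤ)-k) * ((m:ℤ)-k+1) / 2)) = E2 at *
    generalize x ^ (3*k) = E3 at *
    generalize q ^ (k ^ 2 + k * (k - 1) / 2) = E4 at *
    generalize (- -x)^(m:ℤ) = E5 at *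
    generalize q ^ (-((m:ℤ) * (m+1) / 2)) = E6 at *
    field_simp
    linear_combination (1 - x * q^k) * qBinom q (m+n) i * qPoch (-(q/x)) q m *  qPoch (-x) q (1+n) * key

theorem summ (a : ℂ) {q : ℂ} (hq1 : ‖q‖ < 1) : Summable (fun j : ℕ => ‖-(a * q ^ j)‖) := by
  simp only [norm_neg, norm_mul, norm_pow]
  exact (summable_geometric_of_lt_one (norm_nonneg _) hq1).mul_left _

theorem qp_lim (a : ℂ) {q : ℂ} (hq1 : ‖q‖ < 1) :
    Tendsto (qPoch a q) atTop (nhds (qPochInf a q)) := by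
  have := (multipliable_one_add_of_summable (summ a hq1)).tendsto_prod_tprod_nat
  simp only [← sub_eq_add_neg] at this
  exact this

theorem inf_ne {a q : ℂ} (hq1 : ‖q‖ < 1) (h : ∀ j : ℕ, 1 - a * q ^ j ≠ 0) : qPochInf a q ≠ 0 := by
  have := tprod_one_add_ne_zero_of_summable (f := fun j : ℕ => -(a * q ^ j))
    (fun j => by rw [← sub_eq_add_neg]; exact h j) (summ a hq1)
  simp only [← sub_eq_add_neg] at this
  exact this

theorem toNat_lim (c : ℤ) : Tendsto (fun n : ℕ => ((n:ℤ) + c).toNat) atTop atTop := by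
  rw [tendsto_atTop]
  intro b
  filter_upwards [eventually_ge_atTop (b + (-c).toNat)] with n hn
  omega

theorem part2 (q x : ℂ) (hq0 : 0 < ‖q‖) (hq1 : ‖q‖ < 1) (hx : x ≠ 0)
    (hden : ∀ j : ℤ, 1 - x ^ 2 * q ^ j ≠ 0) (k : ℤ) :
      Tendsto (fun p : ℕ × ℕ =>
          qBinom q (p.1 + p.2) ((p.1 : ℤ) + k).toNat *
            (qPoch (-x) q (1 + p.2) * qPoch (-(q / x)) q p.1 /
              (qPochZ (x ^ 2) q (1 + (p.2 : ℤ) + k) *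
                qPochZ (q / x ^ 2) q ((p.1 : ℤ) - k))))
        atTop
        (nhds ((qPochInf q q)⁻¹ *
          (qPochInf (-x) q * qPochInf (-(q / x)) q /
            (qPochInf (x ^ 2) q * qPochInf (q / x ^ 2) q)))) := by
  have hq : q ≠ 0 := norm_pos_iff.mp hq0
  have hx2 : x^2 ≠ 0 := pow_ne_zero _ hx
  have n1 : qPochInf q q ≠ 0 := inf_ne hq1 (q_pow_ne hq1)
  have n2 : qPochInf (x^2) q ≠ 0 := inf_ne hq1 (fun j => by simpa using hden j)
  have n3 : qPochInf (q/x^2) q ≠ 0 := inf_ne hq1 (fun j => by simpa using inv_h hq hx2 hden j)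
  have p1 : Tendsto (fun p : ℕ × ℕ => p.1) atTop atTop := by
    rw [← prod_atTop_atTop_eq]; exact tendsto_fst
  have p2 : Tendsto (fun p : ℕ × ℕ => p.2) atTop atTop := by
    rw [← prod_atTop_atTop_eq]; exact tendsto_snd
  have p12 : Tendsto (fun p : ℕ × ℕ => p.1 + p.2) atTop atTop :=
    tendsto_atTop_mono (fun p => Nat.le_add_right _ _) p1
  have L := qp_lim (hq1 := hq1)
  have l1 := (L q).comp p12
  have l2 := (L q).comp ((toNat_lim k).comp p1)
  have l3 := (L q).comp ((toNat_lim (-k)).comp p2)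
  have l4 := (L (-x)).comp ((toNat_lim 1).comp p2)
  have l5 := (L (-(q/x))).comp p1
  have l6 := (L (x^2)).comp ((toNat_lim (1+k)).comp p2)
  have l7 := (L (q/x^2)).comp ((toNat_lim (-k)).comp p1)
  have big := (l1.div (l2.mul l3) (mul_ne_zero n1 n1)).mul
    ((l4.mul l5).div (l6.mul l7) (mul_ne_zero n2 n3))
  have e : qPochInf q q / (qPochInf q q * qPochInf q q) = (qPochInf q q)⁻¹ := by field_simp
  rw [e] at big
  refine big.congr' ?_
  filter_upwards [p1.eventually_ge_atTop (k.natAbs + 1), p2.eventually_ge_atTop (k.natAbs + 1)]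
    with p h1 h2
  simp only [Function.comp, Pi.div_apply, Pi.mul_apply]
  obtain ⟨a, ha⟩ : ∃ a : ℕ, 1 + (p.2:ℤ) + k = a := ⟨(1 + (p.2:ℤ) + k).toNat, by omega⟩
  obtain ⟨b, hb⟩ : ∃ b : ℕ, (p.1:ℤ) - k = b := ⟨((p.1:ℤ) - k).toNat, by omega⟩
  rw [qBinom, ha, hb, qz_nat, qz_nat,
    show p.1 + p.2 - ((p.1:ℤ) + k).toNat = ((p.2:ℤ) + -k).toNat by omega,
    show ((p.2:ℤ) + 1).toNat = 1 + p.2 by omega,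
    show ((p.2:ℤ) + (1 + k)).toNat = a by omega,
    show ((p.1:ℤ) + -k).toNat = b by omega]

/-- The finite bilateral sums `F_{m,n}(x)` all equal `1`, and for each fixed `k` the
Pochhammer/binomial part of the `k`-th summand converges, as `m, n → ∞`, to
`(1/(q;q)_∞) · (-x;q)_∞ (-q/x;q)_∞ / ((x^2;q)_∞ (q/x^2;q)_∞)`. -/
theorem bilateral_sum_limit (q x : ℂ) (hq0 : 0 < ‖q‖) (hq1 : ‖q‖ < 1) (hx : x ≠ 0)
    (hden : ∀ j : ℤ, 1 - x ^ 2 * q ^ j ≠ 0) :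
    (∀ m n : ℕ,
      (1 : ℂ) = ∑ k ∈ Finset.Icc (-(m : ℤ)) (n : ℤ),
        (1 - x * q ^ k) * qBinom q (m + n) ((m : ℤ) + k).toNat *
          (qPoch (-x) q (1 + n) * qPoch (-(q / x)) q m /
            (qPochZ (x ^ 2) q (1 + (n : ℤ) + k) * qPochZ (q / x ^ 2) q ((m : ℤ) - k))) *
          x ^ (3 * k) * q ^ (k ^ 2 + k * (k - 1) / 2))
    ∧ (∀ k : ℤ,
      Tendsto (fun p : ℕ × ℕ =>
          qBinom q (p.1 + p.2) ((p.1 : ℤ) + k).toNat *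
            (qPoch (-x) q (1 + p.2) * qPoch (-(q / x)) q p.1 /
              (qPochZ (x ^ 2) q (1 + (p.2 : ℤ) + k) *
                qPochZ (q / x ^ 2) q ((p.1 : ℤ) - k))))
        atTop
        (nhds ((qPochInf q q)⁻¹ *
          (qPochInf (-x) q * qPochInf (-(q / x)) q /
            (qPochInf (x ^ 2) q * qPochInf (q / x ^ 2) q))))) := by
  exact ⟨part1 q x hq0 hq1 hx hden, part2 q x hq0 hq1 hx hden⟩
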